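/- arXiv:1708.04269 — 2 statements merged into one kernel-verified Lean document; each statement's English description precedes it below -/
import Mathlib

section
/- ∑_{n≥0} 16^n / ((2n+3)³ (2n+1)² binom(2n,n)²) = (1/2)(7ζ(3) + (3 − 2G)π − 12), where G is Catalan's constant. -/
noncomputable def catalanConst : ℝ := ∑' n : ℕ, (-1 : ℝ) ^ n / (2 * n + 1) ^ 2

noncomputable def zeta3 : ℝ := ∑' n : ℕ, (1 : ℝ) / (n + 1) ^ 3

open Filter Topology MeasureTheory Real Finset

/-- The Wallis integrals `∫ x in 0..π / 2, sin x ^ (2 * n + 1)`, as a product. -/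
noncomputable def wallis (n : ℕ) : ℝ :=
  ∏ i ∈ range n, (2 * (i : ℝ) + 2) / (2 * i + 3)

lemma wallis_succ (n : ℕ) :
    wallis (n + 1) = wallis n * ((2 * (n : ℝ) + 2) / (2 * n + 3)) :=
  prod_range_succ _ _

lemma wallis_pos (n : ℕ) : 0 < wallis n :=
  prod_pos fun i _ => by positivity

lemma wallis_sq (n : ℕ) : (2 * (n : ℝ) + 1) * wallis n ^ 2 = Wallis.W n := by
  induction n with
  | zero => simp [wallis, Wallis.W]
  | succ k ih =>
    rw [Wallis.W_succ, ← ih, wallis_succ]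
    push_cast
    field_simp
    ring

lemma wallis_eq_div_choose (n : ℕ) :
    wallis n = 4 ^ n / ((2 * (n : ℝ) + 1) * Nat.choose (2 * n) n) := by
  induction n with
  | zero => simp [wallis]
  | succ k ih =>
    have h : ((k : ℝ) + 1) * Nat.choose (2 * (k + 1)) (k + 1)
        = 2 * (2 * k + 1) * Nat.choose (2 * k) k := by
      exact_mod_cast Nat.succ_mul_centralBinom_succ k
    have h0 : (0 : ℝ) < Nat.choose (2 * k) k := by
      exact_mod_cast Nat.choose_pos (by omega)
    have h1 : (Nat.choose (2 * (k + 1)) (k + 1) : ℝ)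
        = 2 * (2 * k + 1) * Nat.choose (2 * k) k / (k + 1) := by
      field_simp
      linarith
    rw [wallis_succ, ih, h1]
    push_cast
    field_simp
    ring

lemma tendsto_mul_wallis_sq :
    Tendsto (fun n : ℕ => (2 * (n : ℝ) + 1) * wallis n ^ 2) atTop (𝓝 (π / 2)) := by
  simpa only [wallis_sq] using Wallis.tendsto_W_nhds_pi_div_two

lemma tendsto_wallis_sq : Tendsto (fun n : ℕ => wallis n ^ 2) atTop (𝓝 0) := by
  have h : Tendsto (fun n : ℕ => 2 * (n : ℝ) + 1) atTop atTop :=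
    tendsto_atTop_add_const_right _ _
      (tendsto_natCast_atTop_atTop.const_mul_atTop (by norm_num))
  refine (tendsto_mul_wallis_sq.div_atTop h).congr fun n => ?_
  field_simp

lemma tendsto_wallis : Tendsto wallis atTop (𝓝 0) := by
  have h := tendsto_wallis_sq.sqrt
  simpa [Real.sqrt_sq (wallis_pos _).le] using h

lemma sum_wallis_sq_div_sq (N : ℕ) :
    ∑ n ∈ range N, wallis n ^ 2 / (2 * (n : ℝ) + 3) ^ 2
      = 2 * ((2 * (N : ℝ) + 1) * wallis N ^ 2) + wallis N ^ 2 - 3 := by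
  induction N with
  | zero => norm_num [wallis]
  | succ k ih =>
    rw [sum_range_succ, ih, wallis_succ]
    push_cast
    field_simp
    ring

lemma tendsto_sum_wallis_sq_div_sq :
    Tendsto (fun N => ∑ n ∈ range N, wallis n ^ 2 / (2 * (n : ℝ) + 3) ^ 2) atTop
      (𝓝 (π - 3)) := by
  simp only [sum_wallis_sq_div_sq]
  convert ((tendsto_mul_wallis_sq.const_mul 2).add tendsto_wallis_sq).sub_const 3 using 2
  ring

lemma integral_sin_pow_half (n : ℕ) :
    ∫ x in (0 : ℝ)..π / 2, sin x ^ (2 * n + 1) = wallis n := by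
  induction n with
  | zero => simp [wallis]
  | succ k ih =>
    rw [show 2 * (k + 1) + 1 = 2 * k + 1 + 2 by ring, integral_sin_pow, ih, wallis_succ]
    simp
    field_simp
    ring

lemma integral_sub_mul_sin_pow_mul_cos (n : ℕ) :
    ∫ u in (0 : ℝ)..π / 2, (π / 2 - u) * cos u * sin u ^ (2 * n + 2)
      = wallis (n + 1) / (2 * n + 3) := by
  have hd (u : ℝ) : HasDerivAt (fun u => (π / 2 - u) * sin u ^ (2 * n + 3) / (2 * n + 3))
      ((π / 2 - u) * cos u * sin u ^ (2 * n + 2) - sin u ^ (2 * n + 3) / (2 * n + 3)) u := by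
    have h := ((((hasDerivAt_id u).const_sub (π / 2)).mul
      ((hasDerivAt_sin u).pow (2 * n + 3))).div_const (2 * (n : ℝ) + 3))
    refine h.congr_deriv ?_
    simp only [id, Pi.pow_apply, Nat.add_succ_sub_one]
    push_cast
    field_simp
    ring
  have hi := intervalIntegral.integral_eq_sub_of_hasDerivAt (a := 0) (b := π / 2)
    (fun u _ => hd u) (by apply Continuous.intervalIntegrable; fun_prop)
  rw [intervalIntegral.integral_sub (by apply Continuous.intervalIntegrable; fun_prop)
    (by apply Continuous.intervalIntegrable; fun_prop), intervalIntegral.integral_div,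
    show 2 * n + 3 = 2 * (n + 1) + 1 by ring, integral_sin_pow_half] at hi
  simp at hi
  linarith

/-- The remainder of the expansion `t = cos t * ∑ n, wallis n * sin t ^ (2 * n + 1)`. -/
noncomputable def arcRem (N : ℕ) (t : ℝ) : ℝ :=
  t - cos t * ∑ n ∈ range N, wallis n * sin t ^ (2 * n + 1)

/-- The remainder of the expansion
`sin t - t * cos t = ∑ n, wallis n / (2 * n + 3) * sin t ^ (2 * n + 3)`. -/
noncomputable def sinRem (N : ℕ) (t : ℝ) : ℝ :=
  sin t - t * cos t - ∑ n ∈ range N, wallis n / (2 * n + 3) * sin t ^ (2 * n + 3)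

lemma hasDerivAt_arcRem (N : ℕ) (t : ℝ) :
    HasDerivAt (arcRem N) ((2 * N + 1) * wallis N * sin t ^ (2 * N)) t := by
  induction N with
  | zero =>
    have : arcRem 0 = id := by ext; simp [arcRem]
    rw [this]
    simpa [wallis] using hasDerivAt_id t
  | succ k ih =>
    have e : arcRem (k + 1)
        = fun t => arcRem k t - wallis k * (cos t * sin t ^ (2 * k + 1)) := by
      ext t
      simp only [arcRem, sum_range_succ]
      ring
    rw [e]
    refine (ih.sub (((hasDerivAt_cos t).mul ((hasDerivAt_sin t).pow (2 * k + 1))).const_mul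
      (wallis k))).congr_deriv ?_
    simp only [Pi.pow_apply, Nat.add_sub_cancel, wallis_succ]
    have hc : cos t * cos t = 1 - sin t ^ 2 := by rw [← sq, cos_sq']
    push_cast
    field_simp
    linear_combination (-(2 * k + 3) * wallis k * (2 * k + 1) * sin t ^ (2 * k)) * hc

lemma hasDerivAt_sinRem (N : ℕ) (t : ℝ) :
    HasDerivAt (sinRem N) (sin t * arcRem N t) t := by
  induction N with
  | zero =>
    have : sinRem 0 = fun t => sin t - t * cos t := by ext; simp [sinRem]
    rw [this]
    refine ((hasDerivAt_sin t).sub ((hasDerivAt_id t).mul (hasDerivAt_cos t))).congr_deriv ?_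
    simp [arcRem]
    ring
  | succ k ih =>
    have e : sinRem (k + 1)
        = fun t => sinRem k t - wallis k / (2 * k + 3) * sin t ^ (2 * k + 3) := by
      ext t
      simp only [sinRem, sum_range_succ]
      ring
    rw [e]
    refine (ih.sub (((hasDerivAt_sin t).pow (2 * k + 3)).const_mul
      (wallis k / (2 * k + 3)))).congr_deriv ?_
    simp only [arcRem, sum_range_succ, Nat.add_succ_sub_one]
    push_cast
    field_simp
    ring

lemma nonneg_of_hasDerivAt_nonneg {f f' : ℝ → ℝ} {b : ℝ} (h0 : f 0 = 0)
    (hf : ∀ x, HasDerivAt f (f' x) x) (hf' : ∀ x ∈ Set.Icc 0 b, 0 ≤ f' x)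
    {x : ℝ} (hx : x ∈ Set.Icc 0 b) : 0 ≤ f x := by
  have hm : MonotoneOn f (Set.Icc 0 b) := by
    refine monotoneOn_of_deriv_nonneg (convex_Icc 0 b)
      (fun x _ => (hf x).continuousAt.continuousWithinAt)
      (fun x _ => (hf x).differentiableAt.differentiableWithinAt) fun x hx => ?_
    rw [(hf x).deriv]
    exact hf' x (interior_subset hx)
  rw [← h0]
  exact hm (Set.left_mem_Icc.2 (hx.1.trans hx.2)) hx hx.1

lemma sin_nonneg_of_mem_Icc_half {x : ℝ} (hx : x ∈ Set.Icc 0 (π / 2)) : 0 ≤ sin x :=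
  sin_nonneg_of_nonneg_of_le_pi hx.1 (by linarith [hx.2, pi_pos])

lemma cos_nonneg_of_mem_Icc_half {x : ℝ} (hx : x ∈ Set.Icc 0 (π / 2)) : 0 ≤ cos x :=
  cos_nonneg_of_mem_Icc ⟨by linarith [hx.1, pi_pos], hx.2⟩

lemma arcRem_nonneg (N : ℕ) {x : ℝ} (hx : x ∈ Set.Icc 0 (π / 2)) : 0 ≤ arcRem N x :=
  nonneg_of_hasDerivAt_nonneg (by simp [arcRem]) (hasDerivAt_arcRem N)
    (fun y hy => by
      have := sin_nonneg_of_mem_Icc_half hy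
      have := wallis_pos N
      positivity) hx

lemma sinRem_nonneg (N : ℕ) {x : ℝ} (hx : x ∈ Set.Icc 0 (π / 2)) : 0 ≤ sinRem N x :=
  nonneg_of_hasDerivAt_nonneg (by simp [sinRem]) (hasDerivAt_sinRem N)
    (fun _ hy => mul_nonneg (sin_nonneg_of_mem_Icc_half hy) (arcRem_nonneg N hy)) hx

lemma cos_mul_arcRem_le (N : ℕ) {x : ℝ} (hx : x ∈ Set.Icc 0 (π / 2)) :
    cos x * arcRem N x ≤ wallis N := by
  have h : 0 ≤ wallis N * sin x ^ (2 * N + 1) - cos x * arcRem N x := by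
    refine nonneg_of_hasDerivAt_nonneg (b := π / 2) (f' := fun y => sin y * arcRem N y)
      (f := fun x => wallis N * sin x ^ (2 * N + 1) - cos x * arcRem N x)
      (by simp [arcRem]) (fun y => ?_)
      (fun y hy => mul_nonneg (sin_nonneg_of_mem_Icc_half hy) (arcRem_nonneg N hy)) hx
    refine ((((hasDerivAt_sin y).pow (2 * N + 1)).const_mul (wallis N)).sub
      ((hasDerivAt_cos y).mul (hasDerivAt_arcRem N y))).congr_deriv ?_
    simp only [Nat.add_sub_cancel]
    push_cast
    ring
  have h1 : wallis N * sin x ^ (2 * N + 1) ≤ wallis N :=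
    mul_le_of_le_one_right (wallis_pos N).le
      (pow_le_one₀ (sin_nonneg_of_mem_Icc_half hx) (sin_le_one x))
  linarith

lemma sinRem_le (N : ℕ) {x : ℝ} (hx : x ∈ Set.Icc 0 (π / 2)) :
    sinRem N x ≤ x * sin x * arcRem N x := by
  have h : 0 ≤ x * sin x * arcRem N x - sinRem N x := by
    refine nonneg_of_hasDerivAt_nonneg (b := π / 2)
      (f' := fun y => y * cos y * arcRem N y
        + y * sin y * ((2 * N + 1) * wallis N * sin y ^ (2 * N)))
      (f := fun x => x * sin x * arcRem N x - sinRem N x)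
      (by simp [arcRem, sinRem]) (fun y => ?_) (fun y hy => ?_) hx
    · refine ((((hasDerivAt_id y).mul (hasDerivAt_sin y)).mul (hasDerivAt_arcRem N y)).sub
        (hasDerivAt_sinRem N y)).congr_deriv ?_
      simp
      ring
    · have := sin_nonneg_of_mem_Icc_half hy
      have := cos_nonneg_of_mem_Icc_half hy
      have := arcRem_nonneg N hy
      have := wallis_pos N
      have := hy.1
      positivity
  linarith

lemma sinc_pos_of_mem_Icc {x : ℝ} (hx : x ∈ Set.Icc 0 (π / 2)) : 0 < sinc x := by
  rcases hx.1.eq_or_lt with rfl | h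
  · simp
  · rw [sinc_of_ne_zero h.ne']
    exact div_pos (sin_pos_of_pos_of_lt_pi h (by linarith [hx.2, pi_pos])) h

lemma inv_sinc_mul_sin {x : ℝ} (hx : x ∈ Set.Icc 0 (π / 2)) : (sinc x)⁻¹ * sin x = x := by
  have := sinc_pos_of_mem_Icc hx
  rcases hx.1.eq_or_lt with rfl | h
  · simp
  · rw [sinc_of_ne_zero h.ne'] at *
    have : sin x ≠ 0 := (sin_pos_of_pos_of_lt_pi h (by linarith [hx.2, pi_pos])).ne'
    field_simp

lemma continuousOn_inv_sinc : ContinuousOn (fun x => (sinc x)⁻¹) (Set.uIcc 0 (π / 2)) := by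
  rw [Set.uIcc_of_le pi_div_two_pos.le]
  exact continuous_sinc.continuousOn.inv₀ fun x hx => (sinc_pos_of_mem_Icc hx).ne'

lemma sum_wallis_mul_wallis_succ (N : ℕ) :
    ∑ n ∈ range N, wallis n * wallis (n + 1) / (2 * (n : ℝ) + 3) ^ 2
      = ∫ u in (0 : ℝ)..π / 2,
        ∑ n ∈ range N, wallis n / (2 * n + 3) * ((π / 2 - u) * cos u * sin u ^ (2 * n + 2)) := by
  rw [intervalIntegral.integral_finsetSum
    fun n _ => by apply Continuous.intervalIntegrable; fun_prop]
  refine sum_congr rfl fun n _ => ?_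
  rw [intervalIntegral.integral_const_mul, integral_sub_mul_sin_pow_mul_cos]
  field_simp

lemma norm_sub_sum_le (N : ℕ) {u : ℝ} (hu : u ∈ Set.Ioc 0 (π / 2)) :
    ‖(π / 2 - u) * (cos u - (sinc u)⁻¹ + u * sin u)
      - ∑ n ∈ range N, wallis n / (2 * n + 3) * ((π / 2 - u) * cos u * sin u ^ (2 * n + 2))‖
      ≤ (π / 2) ^ 2 * wallis N := by
  have hu' : u ∈ Set.Icc 0 (π / 2) := Set.Ioc_subset_Icc_self hu
  have hs : 0 < sin u := sin_pos_of_pos_of_lt_pi hu.1 (by linarith [hu.2, pi_pos])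
  have key : (π / 2 - u) * (cos u - (sinc u)⁻¹ + u * sin u)
      - ∑ n ∈ range N, wallis n / (2 * n + 3) * ((π / 2 - u) * cos u * sin u ^ (2 * n + 2))
      = (π / 2 - u) * (cos u * sinRem N u) / sin u := by
    rw [eq_div_iff hs.ne', sub_mul, sum_mul]
    have e : ∑ n ∈ range N, wallis n / (2 * n + 3) * ((π / 2 - u) * cos u * sin u ^ (2 * n + 2))
        * sin u = (π / 2 - u) * cos u *
          ∑ n ∈ range N, wallis n / (2 * n + 3) * sin u ^ (2 * n + 3) := by
      rw [mul_sum]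
      exact sum_congr rfl fun n _ => by ring
    rw [e, sinRem]
    linear_combination (-(π / 2 - u)) * inv_sinc_mul_sin hu' + (π / 2 - u) * u * sin_sq u
  have hc := cos_nonneg_of_mem_Icc_half hu'
  have hp : 0 ≤ π / 2 - u := sub_nonneg.2 hu.2
  have hr := sinRem_nonneg N hu'
  rw [key, Real.norm_of_nonneg (by positivity), div_le_iff₀ hs]
  calc (π / 2 - u) * (cos u * sinRem N u)
      ≤ (π / 2 - u) * (cos u * (u * sin u * arcRem N u)) := by
        gcongr
        exact sinRem_le N hu'
    _ = (π / 2 - u) * u * sin u * (cos u * arcRem N u) := by ring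
    _ ≤ π / 2 * (π / 2) * sin u * wallis N := by
        have := mul_nonneg hc (arcRem_nonneg N hu')
        have := hu.1.le
        have := wallis_pos N
        gcongr
        · linarith
        · exact hu.2
        · exact cos_mul_arcRem_le N hu'
    _ = (π / 2) ^ 2 * wallis N * sin u := by ring

lemma tendsto_sum_wallis_mul_wallis_succ :
    Tendsto (fun N => ∑ n ∈ range N, wallis n * wallis (n + 1) / (2 * (n : ℝ) + 3) ^ 2) atTop
      (𝓝 (∫ u in (0 : ℝ)..π / 2, (π / 2 - u) * (cos u - (sinc u)⁻¹ + u * sin u))) := by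
  rw [tendsto_iff_norm_sub_tendsto_zero]
  have hlim : Tendsto (fun N => (π / 2) ^ 2 * wallis N * |π / 2 - 0|) atTop (𝓝 0) := by
    simpa using (tendsto_wallis.const_mul ((π / 2) ^ 2)).mul_const |π / 2 - 0|
  refine squeeze_zero (fun _ => norm_nonneg _) (fun N => ?_) hlim
  rw [norm_sub_rev, sum_wallis_mul_wallis_succ, ← intervalIntegral.integral_sub]
  · refine intervalIntegral.norm_integral_le_of_norm_le_const fun u hu => ?_
    rw [Set.uIoc_of_le pi_div_two_pos.le] at hu
    exact norm_sub_sum_le N hu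
  · have := continuousOn_inv_sinc
    apply ContinuousOn.intervalIntegrable
    fun_prop
  · apply Continuous.intervalIntegrable
    fun_prop

lemma integral_sub_mul_cos_add :
    ∫ u in (0 : ℝ)..π / 2, (π / 2 - u) * (cos u + u * sin u) = 3 - π / 2 := by
  have hd (u : ℝ) : HasDerivAt
      (fun u => (π / 2 - u) * (2 * sin u - u * cos u) - 2 * cos u - u * sin u - cos u)
      ((π / 2 - u) * (cos u + u * sin u)) u := by
    refine (((((hasDerivAt_id u).const_sub (π / 2)).mul (((hasDerivAt_sin u).const_mul 2).sub
      ((hasDerivAt_id u).mul (hasDerivAt_cos u)))).sub ((hasDerivAt_cos u).const_mul 2)).sub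
      ((hasDerivAt_id u).mul (hasDerivAt_sin u))).sub (hasDerivAt_cos u) |>.congr_deriv ?_
    simp
    ring
  rw [intervalIntegral.integral_eq_sub_of_hasDerivAt (fun u _ => hd u)
    (by apply Continuous.intervalIntegrable; fun_prop)]
  simp
  ring

/-- The Riemann–Lebesgue lemma for cosines on an interval. -/
lemma tendsto_integral_mul_cos {f : ℝ → ℝ} {a b : ℝ} (hab : a ≤ b)
    (hf : IntervalIntegrable f volume a b) :
    Tendsto (fun N : ℕ => ∫ u in a..b, f u * cos (2 * N * u)) atTop (𝓝 0) := by
  have h := Real.tendsto_integral_exp_smul_cocompact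
    ((Set.Ioc a b).indicator fun u => (f u : ℂ))
  have hN : Tendsto (fun N : ℕ => (N : ℝ) / π) atTop (cocompact ℝ) :=
    (tendsto_natCast_atTop_atTop.atTop_div_const pi_pos).mono_right atTop_le_cocompact
  have h1 := (Complex.continuous_re.tendsto _).comp (h.comp hN)
  rw [Complex.zero_re] at h1
  refine h1.congr fun N => ?_
  have e : ∀ v : ℝ, Real.fourierChar (-(v * (N / π))) •
      (Set.Ioc a b).indicator (fun u => (f u : ℂ)) v
      = (Set.Ioc a b).indicator
        (fun u => Complex.exp (((-(2 * N * u) : ℝ) : ℂ) * Complex.I) * f u) v := by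
    intro v
    by_cases hv : v ∈ Set.Ioc a b
    · simp only [Set.indicator_of_mem hv, Circle.smul_def, Real.fourierChar_apply, smul_eq_mul]
      congr 4
      field_simp
    · simp [Set.indicator_of_notMem hv]
  have hf' : IntervalIntegrable (fun u => (f u : ℂ)) volume a b :=
    ⟨hf.1.ofReal, hf.2.ofReal⟩
  have hi : IntervalIntegrable
      (fun u => Complex.exp (((-(2 * N * u) : ℝ) : ℂ) * Complex.I) * f u) volume a b :=
    IntervalIntegrable.continuousOn_mul hf' (by fun_prop)
  simp only [Function.comp, e]
  rw [integral_indicator measurableSet_Ioc, ← intervalIntegral.integral_of_le hab,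
    ← Complex.reCLM_apply, ← Complex.reCLM.intervalIntegral_comp_comm hi]
  refine intervalIntegral.integral_congr fun u _ => ?_
  simp only [Complex.reCLM_apply, Complex.re_mul_ofReal, Complex.exp_ofReal_mul_I_re, cos_neg]
  ring

lemma two_mul_sin_mul_sum_sin (N : ℕ) (u : ℝ) :
    2 * sin u * ∑ k ∈ range N, sin ((2 * k + 1) * u) = 1 - cos (2 * N * u) := by
  induction N with
  | zero => simp
  | succ k ih =>
    rw [sum_range_succ, mul_add, ih]
    have h1 : cos (2 * k * u) = cos ((2 * k + 1) * u - u) := by ring_nf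
    have h2 : cos (2 * (k + 1 : ℕ) * u) = cos ((2 * k + 1) * u + u) := by push_cast; ring_nf
    rw [h1, h2, cos_sub, cos_add]
    ring

lemma integral_sub_mul_self_mul_sin (k : ℕ) :
    ∫ u in (0 : ℝ)..π / 2, (π / 2 - u) * u * sin ((2 * k + 1) * u)
      = 2 / (2 * (k : ℝ) + 1) ^ 3 - π / 2 * ((-1) ^ k / (2 * k + 1) ^ 2) := by
  set m : ℝ := 2 * k + 1 with hm
  have hm0 : m ≠ 0 := by positivity
  have hd (u : ℝ) : HasDerivAt
      (fun u => (π / 2 - 2 * u) * sin (m * u) / m ^ 2 - (π / 2 - u) * u * cos (m * u) / m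
        - 2 * cos (m * u) / m ^ 3)
      ((π / 2 - u) * u * sin (m * u)) u := by
    have hl : HasDerivAt (fun u => m * u) m u := by
      simpa using (hasDerivAt_id u).const_mul m
    refine (((((((hasDerivAt_id u).const_mul 2).const_sub (π / 2)).mul hl.sin).div_const
      (m ^ 2)).sub (((((hasDerivAt_id u).const_sub (π / 2)).mul (hasDerivAt_id u)).mul
      hl.cos).div_const m)).sub ((hl.cos.const_mul 2).div_const (m ^ 3))).congr_deriv ?_
    simp
    field_simp
    ring
  have hs : sin (m * (π / 2)) = (-1) ^ k := by
    rw [show m * (π / 2) = π / 2 + k * π by rw [hm]; ring, sin_add_nat_mul_pi]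
    simp
  have hc : cos (m * (π / 2)) = 0 := by
    rw [show m * (π / 2) = π / 2 + k * π by rw [hm]; ring, cos_add_nat_mul_pi]
    simp
  rw [intervalIntegral.integral_eq_sub_of_hasDerivAt (fun u _ => hd u)
    (by apply Continuous.intervalIntegrable; fun_prop), hs, hc]
  simp
  field_simp
  ring

lemma summable_inv_odd_pow {p : ℕ} (hp : 1 < p) :
    Summable fun k : ℕ => (1 : ℝ) / (2 * k + 1) ^ p := by
  have h := (Real.summable_one_div_nat_pow.2 hp).comp_injective
    (i := fun k : ℕ => 2 * k + 1) fun a b h => by simpa using h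
  simpa [Function.comp_def] using h

lemma hasSum_inv_odd_cube : HasSum (fun k : ℕ => (1 : ℝ) / (2 * k + 1) ^ 3) (7 / 8 * zeta3) := by
  have hs : Summable fun n : ℕ => (1 : ℝ) / n ^ 3 :=
    Real.summable_one_div_nat_pow.2 (by norm_num)
  have hz : ∑' n : ℕ, (1 : ℝ) / n ^ 3 = zeta3 := by
    rw [hs.tsum_eq_zero_add, zeta3]
    simp
  have he : HasSum (fun k : ℕ => (1 : ℝ) / (2 * k : ℕ) ^ 3) (1 / 8 * zeta3) := by
    rw [← hz]
    convert! hs.hasSum.mul_left (1 / 8) using 2 with k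
    push_cast
    rw [mul_pow, one_div_mul_one_div]
    norm_num
  have ho := (summable_inv_odd_pow (p := 3) (by norm_num)).hasSum
  have h := HasSum.even_add_odd (f := fun n : ℕ => (1 : ℝ) / n ^ 3) he (by exact_mod_cast ho)
  push_cast at h
  have := h.unique (hz ▸ hs.hasSum)
  convert ho using 1
  linarith

lemma hasSum_catalanConst :
    HasSum (fun k : ℕ => (-1 : ℝ) ^ k / (2 * k + 1) ^ 2) catalanConst := by
  refine Summable.hasSum (Summable.of_norm ?_)
  convert summable_inv_odd_pow (p := 2) (by norm_num) using 2 with k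
  rw [norm_div, norm_pow, norm_neg, norm_one, one_pow, Real.norm_of_nonneg (by positivity)]

lemma integral_sub_mul_inv_sinc :
    ∫ u in (0 : ℝ)..π / 2, (π / 2 - u) * (sinc u)⁻¹ = 7 / 2 * zeta3 - π * catalanConst := by
  have hq := continuousOn_inv_sinc
  have hint : IntervalIntegrable (fun u => (π / 2 - u) * (sinc u)⁻¹) volume 0 (π / 2) := by
    apply ContinuousOn.intervalIntegrable
    fun_prop
  have hsplit (N : ℕ) : ∫ u in (0 : ℝ)..π / 2, (π / 2 - u) * (sinc u)⁻¹
      = 2 * ∑ k ∈ range N, (2 / (2 * (k : ℝ) + 1) ^ 3 - π / 2 * ((-1) ^ k / (2 * k + 1) ^ 2))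
        + ∫ u in (0 : ℝ)..π / 2, (π / 2 - u) * (sinc u)⁻¹ * cos (2 * N * u) := by
    simp_rw [← integral_sub_mul_self_mul_sin]
    rw [← intervalIntegral.integral_finsetSum
      fun k _ => by apply Continuous.intervalIntegrable; fun_prop,
      ← intervalIntegral.integral_const_mul, ← intervalIntegral.integral_add
        (by apply Continuous.intervalIntegrable; fun_prop)
        (by apply ContinuousOn.intervalIntegrable; fun_prop)]
    refine intervalIntegral.integral_congr fun u hu => ?_
    rw [Set.uIcc_of_le pi_div_two_pos.le] at hu
    simp only [← mul_sum]
    linear_combination (-(π / 2 - u) * (sinc u)⁻¹) * two_mul_sin_mul_sum_sin N u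
      + (π / 2 - u) * 2 * (∑ k ∈ range N, sin ((2 * k + 1) * u)) * inv_sinc_mul_sin hu
  have hsum := (((hasSum_inv_odd_cube.mul_left 2).sub
    (hasSum_catalanConst.mul_left (π / 2))).tendsto_sum_nat.const_mul 2).add
    (tendsto_integral_mul_cos pi_div_two_pos.le hint)
  simp only [mul_one_div, ← hsplit] at hsum
  have := tendsto_nhds_unique hsum tendsto_const_nhds
  linarith

lemma integral_sub_mul_cos_sub_inv_sinc_add :
    ∫ u in (0 : ℝ)..π / 2, (π / 2 - u) * (cos u - (sinc u)⁻¹ + u * sin u)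
      = 3 - π / 2 - (7 / 2 * zeta3 - π * catalanConst) := by
  have hq := continuousOn_inv_sinc
  rw [← integral_sub_mul_cos_add, ← integral_sub_mul_inv_sinc, ← intervalIntegral.integral_sub
    (by apply Continuous.intervalIntegrable; fun_prop)
    (by apply ContinuousOn.intervalIntegrable; fun_prop)]
  congr 1 with u
  ring

theorem stmt_3 :
    ∑' n : ℕ,
        (16 : ℝ) ^ n /
          ((2 * n + 3) ^ 3 * (2 * n + 1) ^ 2 * (Nat.choose (2 * n) n) ^ 2) =
      (1 / 2) * (7 * zeta3 + (3 - 2 * catalanConst) * Real.pi - 12) := by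
  refine HasSum.tsum_eq ((hasSum_iff_tendsto_nat_of_nonneg (fun n => by positivity) _).2 ?_)
  have h := tendsto_sum_wallis_sq_div_sq.sub tendsto_sum_wallis_mul_wallis_succ
  rw [integral_sub_mul_cos_sub_inv_sinc_add] at h
  convert h using 2 with N
  · rw [← sum_sub_distrib]
    refine sum_congr rfl fun n _ => ?_
    have h16 : (16 : ℝ) ^ n = (4 ^ n) ^ 2 := by rw [← pow_mul, mul_comm, pow_mul]; norm_num
    have hw : (16 : ℝ) ^ n / ((2 * n + 3) ^ 3 * (2 * n + 1) ^ 2 * (Nat.choose (2 * n) n) ^ 2)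
        = wallis n ^ 2 / (2 * n + 3) ^ 3 := by
      rw [wallis_eq_div_choose, h16, div_pow, mul_pow, div_div]
      ring_nf
    rw [hw, wallis_succ]
    field_simp
    ring
  · ring
end

section
/- ∑_{n≥1} 1 / (n² · 2^n · binom(3n, n)) = π²/24 − (log 2)²/2. -/
open Set intervalIntegral

theorem integral_pow_mul_one_sub_pow (a b : ℕ) :
    ∫ x in (0:ℝ)..1, x ^ a * (1 - x) ^ b =
      (a.factorial * b.factorial : ℝ) / (a + b + 1).factorial := by
  induction b generalizing a with
  | zero => simp [Nat.factorial_succ]; field_simp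
  | succ b ih =>
    have hftc : ∫ x in (0:ℝ)..1, ((a + 1) * (x ^ a * (1 - x) ^ (b + 1))
        - (b + 1) * (x ^ (a + 1) * (1 - x) ^ b)) = 0 := by
      rw [integral_eq_sub_of_hasDerivAt (f := fun x => x ^ (a + 1) * (1 - x) ^ (b + 1))]
      · simp
      · intro x _
        convert! ((hasDerivAt_pow (a + 1) x).mul
          (((hasDerivAt_id x).const_sub 1).pow (b + 1))) using 1
        simp
        ring
      · exact Continuous.intervalIntegrable (by fun_prop) _ _
    rw [integral_sub (Continuous.intervalIntegrable (by fun_prop) _ _)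
      (Continuous.intervalIntegrable (by fun_prop) _ _), integral_const_mul,
      integral_const_mul, ih (a + 1), sub_eq_zero] at hftc
    have ha : (a + 1 : ℝ) ≠ 0 := by positivity
    apply mul_left_cancel₀ ha
    rw [hftc, show a + 1 + b + 1 = a + (b + 1) + 1 by ring, Nat.factorial_succ a,
      Nat.factorial_succ b]
    push_cast
    ring

/-- The real dilogarithm series `∑ x ^ n / n ^ 2`. -/
noncomputable def dilog (x : ℝ) : ℝ := ∑' n : ℕ, x ^ (n + 1) / (n + 1 : ℝ) ^ 2

theorem summable_one_div_add_one_sq : Summable fun n : ℕ => 1 / (n + 1 : ℝ) ^ 2 := by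
  have h := (summable_nat_add_iff 1).2 (Real.summable_one_div_nat_pow.2 one_lt_two)
  simpa using h

theorem norm_dilog_term_le {x : ℝ} (hx : x ∈ Icc (-1 : ℝ) 1) (n : ℕ) :
    ‖x ^ (n + 1) / (n + 1 : ℝ) ^ 2‖ ≤ 1 / (n + 1 : ℝ) ^ 2 := by
  rw [norm_div, norm_pow, norm_pow, Real.norm_eq_abs, Real.norm_eq_abs,
    abs_of_pos (by positivity : (0 : ℝ) < n + 1)]
  gcongr
  exact pow_le_one₀ (abs_nonneg x) (abs_le.2 hx)

theorem summable_dilog {x : ℝ} (hx : x ∈ Icc (-1 : ℝ) 1) :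
    Summable fun n : ℕ => x ^ (n + 1) / (n + 1 : ℝ) ^ 2 :=
  .of_norm_bounded summable_one_div_add_one_sq (norm_dilog_term_le hx)

theorem continuousOn_dilog : ContinuousOn dilog (Icc (-1) 1) :=
  continuousOn_tsum (fun n => by fun_prop) summable_one_div_add_one_sq
    fun n _ hx => norm_dilog_term_le hx n

theorem dilog_zero : dilog 0 = 0 := by simp [dilog]

theorem hasDerivAt_dilog {x : ℝ} (hx : |x| < 1) (h0 : x ≠ 0) :
    HasDerivAt dilog (-Real.log (1 - x) / x) x := by
  obtain ⟨r, hxr, hr⟩ := exists_between hx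
  have hr0 : 0 ≤ r := (abs_nonneg x).trans hxr.le
  have h := hasDerivAt_tsum_of_isPreconnected (𝕜 := ℝ) (u := fun n : ℕ => r ^ n)
    (g := fun (n : ℕ) (y : ℝ) => y ^ (n + 1) / (n + 1 : ℝ) ^ 2)
    (g' := fun (n : ℕ) (y : ℝ) => y ^ n / (n + 1 : ℝ)) (t := Ioo (-r) r) (y₀ := x) (y := x)
    (summable_geometric_of_lt_one hr0 hr) isOpen_Ioo isPreconnected_Ioo
    (fun n y _ => by
      convert! (hasDerivAt_pow (n + 1) y).div_const ((n + 1 : ℝ) ^ 2) using 1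
      simp
      field_simp)
    (fun n y hy => by
      rw [norm_div, norm_pow, Real.norm_eq_abs, Real.norm_eq_abs,
        abs_of_pos (by positivity : (0 : ℝ) < n + 1)]
      refine (div_le_self (by positivity) (by linarith [n.cast_nonneg (α := ℝ)])).trans ?_
      gcongr
      exact (abs_lt.2 hy).le)
    (abs_lt.1 hxr) (summable_dilog (abs_le.1 hx.le)) (abs_lt.1 hxr)
  convert! h using 1
  rw [← (Real.hasSum_pow_div_log_of_abs_lt_one hx).tsum_eq, ← tsum_div_const]
  congr 1 with n
  field_simp
  ring

theorem dilog_neg_one : dilog (-1) = -(Real.pi ^ 2 / 12) := by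
  have hz : HasSum (fun n : ℕ => 1 / (n + 1 : ℝ) ^ 2) (Real.pi ^ 2 / 6) := by
    simpa using (hasSum_nat_add_iff' 1).2 hasSum_zeta_two
  have hd := (summable_dilog (x := -1) (by simp)).hasSum
  have hodd : HasSum (fun n : ℕ => 1 / (2 * n + 1 + 1 : ℝ) ^ 2) (Real.pi ^ 2 / 24) := by
    convert! hz.mul_left (1 / 4) using 1
    · ext n; field_simp; ring
    · ring
  have hs : HasSum (fun n : ℕ => 1 / (n + 1 : ℝ) ^ 2 + (-1) ^ (n + 1) / (n + 1 : ℝ) ^ 2)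
      (0 + 2 * (Real.pi ^ 2 / 24)) := by
    apply HasSum.even_add_odd
    · convert! hasSum_zero using 1
      ext n
      simp [pow_succ (-1 : ℝ), pow_mul, neg_div]
    · convert! hodd.mul_left 2 using 1
      ext n
      simp [pow_succ, pow_mul]
      ring
  have := hs.unique (hz.add hd)
  simp only [dilog]
  linarith

theorem dilog_one_half : dilog (1 / 2) = Real.pi ^ 2 / 12 - Real.log 2 ^ 2 / 2 := by
  have hmem : ∀ x ∈ Icc (-1 : ℝ) 0, x / (x - 1) ∈ Icc (-1 : ℝ) 1 := by
    intro x hx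
    have : x - 1 < 0 := by linarith [hx.2]
    constructor
    · rw [le_div_iff_of_neg this]; linarith [hx.2]
    · rw [div_le_iff_of_neg this]; linarith [hx.2]
  have h := integral_eq_sub_of_hasDerivAt_of_le (a := (-1 : ℝ)) (b := 0) (f' := fun _ => (0:ℝ))
    (f := fun x => dilog x + dilog (x / (x - 1)) + Real.log (1 - x) ^ 2 / 2) (by norm_num)
    (by
      refine ((continuousOn_dilog.mono (Icc_subset_Icc le_rfl zero_le_one)).add
        (continuousOn_dilog.comp (continuousOn_id.div (by fun_prop) ?_) hmem)).add
        (((ContinuousOn.log (by fun_prop) ?_).pow 2).div_const 2)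
      · intro x hx; linarith [hx.2]
      · intro x hx; linarith [hx.2])
    (by
      intro x hx
      have hx1 : x - 1 < 0 := by linarith [hx.2]
      have hx2 : 0 < 1 - x := by linarith [hx.2]
      have hx0 : x ≠ 0 := hx.2.ne
      have hq : |x / (x - 1)| < 1 := by
        rw [abs_lt]
        constructor
        · rw [lt_div_iff_of_neg hx1]; linarith [hx.2]
        · rw [div_lt_iff_of_neg hx1]; linarith [hx.2]
      have h1 := hasDerivAt_dilog (abs_lt.2 ⟨hx.1, hx.2.trans one_pos⟩) hx0
      have h2 := (hasDerivAt_dilog hq (div_ne_zero hx0 hx1.ne)).comp x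
        ((hasDerivAt_id x).div ((hasDerivAt_id x).sub_const 1) hx1.ne)
      have h3 := ((((hasDerivAt_id x).const_sub 1).log hx2.ne').pow 2).div_const 2
      convert! (h1.add h2).add h3 using 1
      have hl : Real.log (1 - x / (x - 1)) = -Real.log (1 - x) := by
        rw [← Real.log_inv]
        congr 1
        field_simp [hx1.ne, hx2.ne']
        ring
      have := hx1.ne
      have := hx2.ne'
      simp only [id, hl]
      rw [show x - 1 = -(1 - x) by ring]
      field_simp
      ring)
    (by simp)
  norm_num [dilog_zero, dilog_neg_one] at h
  rw [one_div]
  linarith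

theorem one_div_choose_three_mul_eq_integral (n : ℕ) :
    (1 : ℝ) / ((n + 1) ^ 2 * 2 ^ (n + 1) * (Nat.choose (3 * (n + 1)) (n + 1))) =
      ∫ x in (0:ℝ)..1, 1 / ((n + 1) * 2 ^ (n + 1)) * (x ^ n * (1 - x) ^ (2 * (n + 1))) := by
  rw [integral_const_mul, integral_pow_mul_one_sub_pow,
    Nat.cast_choose ℝ (by lia : n + 1 ≤ 3 * (n + 1)),
    show 3 * (n + 1) - (n + 1) = 2 * (n + 1) by lia,
    show n + 2 * (n + 1) + 1 = 3 * (n + 1) by lia, Nat.factorial_succ n]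
  push_cast
  field_simp

theorem norm_integrand_le (n : ℕ) {x : ℝ} (hx : x ∈ Icc (0 : ℝ) 1) :
    ‖1 / ((n + 1) * 2 ^ (n + 1)) * (x ^ n * (1 - x) ^ (2 * (n + 1)))‖ ≤ (1 / 2 : ℝ) ^ n := by
  have h1 : 0 ≤ 1 - x := by linarith [hx.2]
  have h2 : x ^ n ≤ 1 := pow_le_one₀ hx.1 hx.2
  have h3 : (1 - x) ^ (2 * (n + 1)) ≤ 1 := pow_le_one₀ h1 (by linarith [hx.1])
  have h0 := hx.1
  rw [Real.norm_of_nonneg (by positivity)]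
  calc _ ≤ 1 / ((n + 1) * 2 ^ (n + 1)) * (1 * 1 : ℝ) := by gcongr
    _ ≤ 1 / (1 * 2 ^ n) * (1 * 1 : ℝ) := by gcongr <;> simp
    _ = _ := by simp

theorem hasSum_integrand {x : ℝ} (hx : x ∈ Ioo (0 : ℝ) 1) :
    HasSum (fun n : ℕ => 1 / ((n + 1) * 2 ^ (n + 1)) * (x ^ n * (1 - x) ^ (2 * (n + 1))))
      (-(Real.log (1 - x / 2) + Real.log (1 + x ^ 2)) / x) := by
  have hx0 := hx.1
  have hx1 := hx.2
  have hy : |x * (1 - x) ^ 2 / 2| < 1 := by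
    rw [abs_of_nonneg (by positivity)]
    have : (1 - x) ^ 2 ≤ 1 := pow_le_one₀ (by linarith) (by linarith)
    nlinarith
  convert! (Real.hasSum_pow_div_log_of_abs_lt_one hy).div_const x using 1
  · ext n
    rw [div_pow, mul_pow, ← pow_mul, pow_succ x n]
    field_simp
  · rw [← Real.log_mul (by linarith) (by positivity)]
    congr 3
    ring

theorem integral_tsum_integrand :
    ∫ x in (0:ℝ)..1, (∑' n : ℕ, 1 / ((n + 1) * 2 ^ (n + 1)) * (x ^ n * (1 - x) ^ (2 * (n + 1)))) =
      Real.pi ^ 2 / 24 - Real.log 2 ^ 2 / 2 := by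
  rw [integral_eq_sub_of_hasDerivAt_of_le
    (f := fun x => dilog (x / 2) + dilog (-x ^ 2) / 2) zero_le_one]
  · norm_num [dilog_zero, dilog_neg_one]
    rw [dilog_one_half]
    ring
  · refine (continuousOn_dilog.comp (by fun_prop) ?_).add
      ((continuousOn_dilog.comp (by fun_prop) ?_).div_const 2)
    · intro x hx
      constructor <;> linarith [hx.1, hx.2]
    · intro x hx
      constructor <;> nlinarith [hx.1, hx.2]
  · intro x hx
    have hx0 := hx.1
    have hx1 := hx.2
    rw [(hasSum_integrand hx).tsum_eq]
    have h1 := (hasDerivAt_dilog (x := x / 2) (by rw [abs_lt]; constructor <;> linarith)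
      (by positivity)).comp x ((hasDerivAt_id x).div_const 2)
    have h2 := ((hasDerivAt_dilog (x := -x ^ 2) (by rw [abs_lt]; constructor <;> nlinarith)
      (neg_ne_zero.2 (by positivity))).comp x (hasDerivAt_pow 2 x).neg).div_const 2
    convert! h1.add h2 using 1
    rw [sub_neg_eq_add]
    field_simp
    ring
  · apply ContinuousOn.intervalIntegrable_of_Icc zero_le_one
    exact continuousOn_tsum (fun n => by fun_prop)
      (summable_geometric_of_lt_one (by norm_num) one_half_lt_one)
      fun n x hx => norm_integrand_le n hx

theorem stmt_7 :
    ∑' n : ℕ,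
        (1 : ℝ) / ((n + 1) ^ 2 * 2 ^ (n + 1) * (Nat.choose (3 * (n + 1)) (n + 1))) =
      Real.pi ^ 2 / 24 - Real.log 2 ^ 2 / 2 := by
  simp_rw [one_div_choose_three_mul_eq_integral]
  rw [← integral_tsum_integrand]
  refine (hasSum_integral_of_dominated_convergence (fun n _ => (1 / 2 : ℝ) ^ n)
    ?_ ?_ ?_ ?_ ?_).tsum_eq
  · exact fun n => Continuous.aestronglyMeasurable (by fun_prop)
  · refine fun n => .of_forall fun x hx => norm_integrand_le n ?_
    rw [uIoc_of_le zero_le_one] at hx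
    exact Ioc_subset_Icc_self hx
  · exact .of_forall fun _ _ => summable_geometric_of_lt_one (by norm_num) one_half_lt_one
  · simp
  · refine .of_forall fun x hx => ?_
    rw [uIoc_of_le zero_le_one] at hx
    exact (Summable.of_norm_bounded (summable_geometric_of_lt_one (by norm_num) one_half_lt_one)
      fun n => norm_integrand_le n (Ioc_subset_Icc_self hx)).hasSum
end
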